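/- Let q be a prime power, F a finite extension field of GF(q), and let G ∈ F[X] be a separable (squarefree) polynomial of degree τ ≥ 1. Let α₁, …, αₙ be pairwise distinct elements of F with G(αᵢ) ≠ 0 for all i. Then every nonzero codeword of the q-ary Goppa code Γ(L, G^{q−1}) has Hamming weight at least q·τ + 1. -/

import Mathlib

open Polynomial

/-- The syndrome polynomial `Σᵢ cᵢ ∏_{j≠i} (X − αⱼ)` of a word `c ∈ GF(q)ⁿ` with respect to
the locator tuple `α`, with coefficients viewed in the extension field `F`. -/
noncomputable def goppaSum {K F : Type*} [Field K] [Field F] [Algebra K F] {n : ℕ}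
    (α : Fin n → F) (c : Fin n → K) : Polynomial F :=
  ∑ i, Polynomial.C (algebraMap K F (c i)) *
    ∏ j ∈ Finset.univ.erase i, (Polynomial.X - Polynomial.C (α j))

theorem goppaSum_map {K F E : Type*} [Field K] [Field F] [Field E] [Algebra K F] [Algebra F E]
    [Algebra K E] [IsScalarTower K F E] {n : ℕ} (α : Fin n → F) (c : Fin n → K) :
    (goppaSum α c).map (algebraMap F E) = goppaSum (fun i => algebraMap F E (α i)) c := by
  simp [goppaSum, Polynomial.map_sum, Polynomial.map_prod, ← IsScalarTower.algebraMap_apply]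

theorem goppaSum_eval {K F : Type*} [Field K] [Field F] [Algebra K F] {n : ℕ}
    (α : Fin n → F) (c : Fin n → K) (β : F) (hβ : ∀ i, α i ≠ β) :
    (goppaSum α c).eval β =
      -(∏ j, (β - α j)) * ∑ i, algebraMap K F (c i) * (α i - β)⁻¹ := by
  simp only [goppaSum, eval_finsetSum, eval_mul, eval_C, eval_prod, eval_sub, eval_X]
  rw [Finset.mul_sum]
  refine Finset.sum_congr rfl fun i _ => ?_
  rw [← Finset.mul_prod_erase Finset.univ (fun j => β - α j) (Finset.mem_univ i)]
  have h : α i - β ≠ 0 := sub_ne_zero.2 (hβ i)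
  field_simp
  ring

/-- Multiplying the expansion of `Σᵢ cᵢ / (X − αᵢ)` at `β` up to order `m` by `∏ⱼ (X − αⱼ)`
gives `−goppaSum α c` modulo `(X − β) ^ m`. -/
theorem X_sub_C_pow_dvd_goppaSum_add {K F : Type*} [Field K] [Field F] [Algebra K F] {n : ℕ}
    (α : Fin n → F) (c : Fin n → K) (β : F) (hβ : ∀ i, α i ≠ β) (m : ℕ) :
    (X - C β) ^ m ∣ goppaSum α c + (∏ j, (X - C (α j))) *
      ∑ k ∈ Finset.range m,
        C (∑ i, algebraMap K F (c i) * (α i - β)⁻¹ ^ (k + 1)) * (X - C β) ^ k := by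
  have hswap : ∑ k ∈ Finset.range m,
        C (∑ i, algebraMap K F (c i) * (α i - β)⁻¹ ^ (k + 1)) * (X - C β) ^ k =
      ∑ i, C (algebraMap K F (c i)) * ∑ k ∈ Finset.range m,
        C ((α i - β)⁻¹ ^ (k + 1)) * (X - C β) ^ k := by
    simp only [map_sum, Finset.sum_mul, Finset.mul_sum]
    rw [Finset.sum_comm]
    simp only [C_mul, mul_assoc]
  rw [hswap, goppaSum, Finset.mul_sum, ← Finset.sum_add_distrib]
  refine Finset.dvd_sum fun i _ => ?_
  have ht : α i - β ≠ 0 := sub_ne_zero.2 (hβ i)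
  have hgeom : (X - C (α i)) * ∑ k ∈ Finset.range m,
      C ((α i - β)⁻¹ ^ (k + 1)) * (X - C β) ^ k = C ((α i - β)⁻¹ ^ m) * (X - C β) ^ m - 1 := by
    have hlin : X - C (α i) = C (α i - β) * (C (α i - β)⁻¹ * (X - C β) - 1) := by
      rw [mul_sub, ← mul_assoc, ← C_mul, mul_inv_cancel₀ ht, C_sub, C_1]
      ring
    have hsum : ∑ k ∈ Finset.range m, C ((α i - β)⁻¹ ^ (k + 1)) * (X - C β) ^ k =
        C (α i - β)⁻¹ * ∑ k ∈ Finset.range m, (C (α i - β)⁻¹ * (X - C β)) ^ k := by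
      rw [Finset.mul_sum]
      refine Finset.sum_congr rfl fun k _ => ?_
      rw [mul_pow, ← C_pow, ← mul_assoc, ← C_mul, pow_succ']
    have hone : C (α i - β) * C (α i - β)⁻¹ = 1 := by
      rw [← C_mul, mul_inv_cancel₀ ht, C_1]
    rw [hsum, C_pow, ← mul_pow, ← mul_geom_sum]
    nth_rewrite 1 [hlin]
    linear_combination ((C (α i - β)⁻¹ * (X - C β) - 1) *
      ∑ k ∈ Finset.range m, (C (α i - β)⁻¹ * (X - C β)) ^ k) * hone
  refine ⟨C (algebraMap K F (c i)) * (∏ j ∈ Finset.univ.erase i, (X - C (α j))) *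
    C ((α i - β)⁻¹ ^ m), ?_⟩
  rw [← Finset.mul_prod_erase Finset.univ (fun j => X - C (α j)) (Finset.mem_univ i)]
  linear_combination
    (C (algebraMap K F (c i)) * ∏ j ∈ Finset.univ.erase i, (X - C (α j))) * hgeom

theorem X_sub_C_pow_card_dvd_goppaSum {K F : Type*} [Field K] [Fintype K] [Field F] [Algebra K F]
    {n : ℕ} (α : Fin n → F) (c : Fin n → K) (β : F) (hβ : ∀ i, α i ≠ β)
    (h : (X - C β) ^ (Fintype.card K - 1) ∣ goppaSum α c) :
    (X - C β) ^ Fintype.card K ∣ goppaSum α c := by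
  obtain ⟨m, hm⟩ : ∃ m, Fintype.card K = m + 1 := ⟨Fintype.card K - 1, by
    have := Fintype.card_pos (α := K)
    omega⟩
  have hm0 : m ≠ 0 := by
    have := Fintype.one_lt_card (α := K)
    omega
  rw [hm, Nat.add_sub_cancel] at h
  rw [hm]
  have hfirst : ∑ i, algebraMap K F (c i) * (α i - β)⁻¹ = 0 := by
    have hroot : (goppaSum α c).eval β = 0 :=
      dvd_iff_isRoot.1 ((dvd_pow_self _ hm0).trans h)
    rw [goppaSum_eval α c β hβ] at hroot
    refine (mul_eq_zero.1 hroot).resolve_left (neg_ne_zero.2 ?_)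
    exact Finset.prod_ne_zero_iff.2 fun j _ => sub_ne_zero.2 (hβ j).symm
  have hlast : ∑ i, algebraMap K F (c i) * (α i - β)⁻¹ ^ (m + 1) = 0 := by
    have := congrArg (FiniteField.frobeniusAlgHom K F) hfirst
    simpa only [map_sum, map_mul, map_zero, AlgHom.commutes, FiniteField.coe_frobeniusAlgHom,
      hm] using this
  have hexp := X_sub_C_pow_dvd_goppaSum_add α c β hβ (m + 1)
  rw [Finset.sum_range_succ, hlast, C_0, zero_mul, add_zero] at hexp
  have hcop : IsCoprime ((X - C β) ^ m) (∏ j, (X - C (α j))) :=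
    (IsCoprime.prod_right fun j _ => isCoprime_X_sub_C_of_isUnit_sub
      (sub_ne_zero.2 (hβ j).symm).isUnit).pow_left
  have hdvd := hcop.dvd_of_dvd_mul_left
    ((dvd_add_right h).1 ((pow_dvd_pow _ m.le_succ).trans hexp))
  have hzero := eq_zero_of_dvd_of_degree_lt hdvd (by
    rw [degree_pow, degree_X_sub_C, nsmul_one]
    refine (degree_sum_le _ _).trans_lt
      ((Finset.sup_lt_iff (WithBot.bot_lt_coe m)).2 fun k hk => ?_)
    refine (degree_mul_le _ _).trans_lt ?_
    rw [degree_pow, degree_X_sub_C, nsmul_one]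
    refine (add_le_add_left degree_C_le _).trans_lt ?_
    rw [zero_add]
    exact Nat.cast_lt.2 (Finset.mem_range.1 hk))
  rwa [hzero, mul_zero, add_zero] at hexp

theorem pow_card_dvd_goppaSum {K F : Type*} [Field K] [Fintype K] [Field F] [Algebra K F]
    {n : ℕ} (G : F[X]) (hG : G.Separable) (α : Fin n → F) (heval : ∀ i, G.eval (α i) ≠ 0)
    (c : Fin n → K) (h : G ^ (Fintype.card K - 1) ∣ goppaSum α c) :
    G ^ Fintype.card K ∣ goppaSum α c := by
  classical
  let E := AlgebraicClosure F
  rw [← map_dvd_map' (algebraMap F E), goppaSum_map, Polynomial.map_pow] at h ⊢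
  have hsplit : (G.map (algebraMap F E)).Splits := IsAlgClosed.splits _
  have hsep : (G.map (algebraMap F E)).Separable := hG.map
  have hG0 : G.map (algebraMap F E) ≠ 0 := hsep.ne_zero
  have hne : ∀ β ∈ (G.map (algebraMap F E)).roots, ∀ i, algebraMap F E (α i) ≠ β := by
    rintro β hβ i rfl
    rw [mem_roots hG0, IsRoot.def, eval_map_algebraMap, aeval_algebraMap_apply,
      coe_aeval_eq_eval, map_eq_zero] at hβ
    exact heval i hβ
  have hprod : G.map (algebraMap F E) = C (G.map (algebraMap F E)).leadingCoeff *
      ∏ β ∈ (G.map (algebraMap F E)).roots.toFinset, (X - C β) := by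
    conv_lhs => rw [hsplit.eq_prod_roots]
    rw [Finset.prod, Multiset.toFinset_val, (nodup_roots hsep).dedup]
  have hunit : IsUnit (C (G.map (algebraMap F E)).leadingCoeff ^ Fintype.card K) :=
    (isUnit_C.2 (leadingCoeff_ne_zero.2 hG0).isUnit).pow _
  have hroots : ∏ β ∈ (G.map (algebraMap F E)).roots.toFinset, (X - C β) ^ Fintype.card K ∣
      goppaSum (fun i => algebraMap F E (α i)) c := by
    refine Finset.prod_dvd_of_coprime (fun a _ b _ hab => ?_) fun β hβ => ?_
    · exact (isCoprime_X_sub_C_of_isUnit_sub (sub_ne_zero.2 hab).isUnit).pow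
    · rw [Multiset.mem_toFinset] at hβ
      refine X_sub_C_pow_card_dvd_goppaSum _ c β (hne β hβ) (dvd_trans (pow_dvd_pow_of_dvd ?_ _) h)
      exact dvd_iff_isRoot.2 (isRoot_of_mem_roots hβ)
  rw [hprod, mul_pow, hunit.mul_left_dvd, ← Finset.prod_pow]
  exact hroots

theorem goppaSum_ne_zero {K F : Type*} [Field K] [Field F] [Algebra K F] {n : ℕ}
    (α : Fin n → F) (hα : Function.Injective α) (c : Fin n → K) (hc0 : c ≠ 0) :
    goppaSum α c ≠ 0 := by
  obtain ⟨i, hi⟩ := Function.ne_iff.1 hc0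
  intro h
  have hev := congrArg (eval (α i)) h
  simp only [goppaSum, eval_finsetSum, eval_mul, eval_C, eval_prod, eval_sub, eval_X,
    eval_zero] at hev
  rw [Finset.sum_eq_single i (fun k _ hk => ?_) (by simp)] at hev
  · refine mul_ne_zero ((_root_.map_ne_zero _).2 hi) (Finset.prod_ne_zero_iff.2 fun j hj => ?_) hev
    exact sub_ne_zero.2 (hα.ne (Finset.ne_of_mem_erase hj).symm)
  · exact mul_eq_zero_of_right _
      (Finset.prod_eq_zero (Finset.mem_erase.2 ⟨hk.symm, Finset.mem_univ i⟩) (sub_self _))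

theorem degree_goppaSum_lt {K F : Type*} [Field K] [Field F] [Algebra K F] {n : ℕ}
    (α : Fin n → F) (c : Fin n → K) : (goppaSum α c).degree < n := by
  refine (degree_sum_le _ _).trans_lt ((Finset.sup_lt_iff (WithBot.bot_lt_coe n)).2 fun i _ => ?_)
  refine (degree_mul_le _ _).trans_lt ((add_le_add_left degree_C_le _).trans_lt ?_)
  rw [zero_add, degree_prod]
  simp only [degree_X_sub_C, Finset.sum_const, nsmul_one, Finset.card_erase_of_mem,
    Finset.mem_univ, Finset.card_univ, Fintype.card_fin]
  exact Nat.cast_lt.2 (Nat.sub_lt i.pos one_pos)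

theorem natDegree_add_one_le_weight_of_dvd_goppaSum {K F : Type*} [Field K] [DecidableEq K]
    [Field F] [Algebra K F] {n : ℕ} (H : F[X]) (α : Fin n → F) (hα : Function.Injective α)
    (heval : ∀ i, H.eval (α i) ≠ 0) (c : Fin n → K) (hc : H ∣ goppaSum α c) (hc0 : c ≠ 0) :
    H.natDegree + 1 ≤ (Finset.univ.filter fun i => c i ≠ 0).card := by
  have hS := goppaSum_ne_zero α hα c hc0
  have hlocators : ∏ j with c j = 0, (X - C (α j)) ∣ goppaSum α c := by
    refine Finset.dvd_sum fun i _ => ?_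
    by_cases hi : c i = 0
    · simp [hi]
    · refine dvd_mul_of_dvd_right (Finset.prod_dvd_prod_of_subset _ _ _ fun j hj => ?_) _
      refine Finset.mem_erase.2 ⟨?_, Finset.mem_univ j⟩
      rintro rfl
      exact hi (Finset.mem_filter.1 hj).2
  have hcop : IsCoprime (∏ j with c j = 0, (X - C (α j))) H :=
    IsCoprime.prod_left fun j _ =>
      (irreducible_X_sub_C (α j)).coprime_iff_not_dvd.2 fun h => heval j (dvd_iff_isRoot.1 h)
  have hle := natDegree_le_of_dvd (hcop.mul_dvd hlocators hc) hS
  have hlt : (goppaSum α c).natDegree < n :=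
    (natDegree_lt_iff_degree_lt hS).2 (degree_goppaSum_lt α c)
  rw [natDegree_mul (monic_prod_X_sub_C _ _).ne_zero (ne_zero_of_dvd_ne_zero hS hc),
    natDegree_finsetProd_X_sub_C_eq_card] at hle
  have hcard := Finset.card_filter_add_card_filter_not (s := Finset.univ) fun i => c i = 0
  rw [Finset.card_univ, Fintype.card_fin] at hcard
  simp only [ne_eq]
  omega

/-- every nonzero codeword of the Goppa code `Γ(L, G^{q−1})`, with `G`
separable of degree `τ ≥ 1`, has Hamming weight at least `q·τ + 1`. -/
theorem goppa_code_sep_pow_q_sub_one_min_weight {K F : Type*} [Field K] [Fintype K]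
    [DecidableEq K] [Field F] [Fintype F] [Algebra K F] {n τ : ℕ}
    (G : Polynomial F) (hsq : Squarefree G) (hdeg : G.natDegree = τ) (hτ : 1 ≤ τ)
    (α : Fin n → F) (hα : Function.Injective α)
    (heval : ∀ i, G.eval (α i) ≠ 0)
    (c : Fin n → K)
    (hc : G ^ (Fintype.card K - 1) ∣ goppaSum α c) (hc0 : c ≠ 0) :
    Fintype.card K * τ + 1 ≤ (Finset.univ.filter fun i => c i ≠ 0).card := by
  rw [← hdeg, ← natDegree_pow]
  refine natDegree_add_one_le_weight_of_dvd_goppaSum _ α hα (fun i => ?_) c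
    (pow_card_dvd_goppaSum G (PerfectField.separable_iff_squarefree.2 hsq) α heval c hc) hc0
  rw [eval_pow]
  exact pow_ne_zero _ (heval i)
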